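/- (Upper bound on the optimal allocation cost.) Let G be a finite connected simple graph on a vertex set V of n players with vertex degrees d_i = deg(i), and let O be a finite set of resources with |O| ≥ 2. Then there exists an allocation P : V → O such that C(P) ≤ n(2|O| − 1) + |O|(|O| − 1)·Σ_{i∈V} (1 − 1/|O|)^{d_i}. -/

import Mathlib

open Finset

noncomputable section

variable {V O : Type*} [Fintype V] [DecidableEq V] [Fintype O] [DecidableEq O]

/-- Diameter of the graph: maximum graph distance between any two vertices. -/
def csrDiam (G : SimpleGraph V) : ℕ :=
  Finset.sup Finset.univ fun i => Finset.sup Finset.univ fun j => G.dist i j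

/-- Distance from player `i` to the nearest holder of resource `o` under allocation `P`;
`csrDiam G + 1` if no one holds `o`. -/
def csrDist (G : SimpleGraph V) (P : V → O) (i : V) (o : O) : ℕ :=
  if h : (Finset.univ.filter fun j => P j = o).Nonempty then
    (Finset.univ.filter fun j => P j = o).inf' h fun j => G.dist i j
  else csrDiam G + 1

/-- Cost of player `i` under allocation `P`. -/
def csrCost (G : SimpleGraph V) (P : V → O) (i : V) : ℕ :=
  ∑ o ∈ Finset.univ.filter (fun o => o ≠ P i), csrDist G P i o

/-- Total cost of allocation `P`. -/
def csrTotal (G : SimpleGraph V) (P : V → O) : ℕ := ∑ i, csrCost G P i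

/-- Radius of player `i`: distance to nearest *other* player holding the same resource;
`csrDiam G` if there is none. -/
def csrRadius (G : SimpleGraph V) (P : V → O) (i : V) : ℕ :=
  if h : (Finset.univ.filter fun j => j ≠ i ∧ P j = P i).Nonempty then
    (Finset.univ.filter fun j => j ≠ i ∧ P j = P i).inf' h fun j => G.dist i j
  else csrDiam G

/-- Ball of radius `r` (a natural number) around `i`. -/
def csrBall (G : SimpleGraph V) (i : V) (r : ℕ) : Finset V :=
  Finset.univ.filter fun j => G.dist i j ≤ r

/-- Pure Nash equilibrium of the CSR game. -/
def csrIsNE (G : SimpleGraph V) (P : V → O) : Prop :=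
  ∀ (i : V) (o : O), csrCost G P i ≤ csrCost G (Function.update P i o) i


lemma aux_level (G : SimpleGraph V) (hconn : G.Connected) (u v : V) (t : ℕ)
    (ht : t ≤ G.dist u v) : ∃ w, G.dist u w = t := by
  obtain ⟨p, hp⟩ := hconn.exists_walk_length_eq_dist u v
  refine ⟨p.getVert t, ?_⟩
  have h1 : G.dist u (p.getVert t) ≤ t := by
    have := SimpleGraph.dist_le (p.take t)
    rw [SimpleGraph.Walk.take_length] at this
    omega
  have h2 : G.dist (p.getVert t) v ≤ p.length - t := by
    have := SimpleGraph.dist_le (p.drop t)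
    rw [SimpleGraph.Walk.drop_length] at this
    omega
  have h3 := hconn.dist_triangle (u := u) (v := p.getVert t) (w := v)
  omega

lemma aux_diam_le (G : SimpleGraph V) (i j : V) : G.dist i j ≤ csrDiam G := by
  unfold csrDiam
  exact le_trans (Finset.le_sup (f := fun j => G.dist i j) (mem_univ j))
    (Finset.le_sup (f := fun i => Finset.sup Finset.univ fun j => G.dist i j) (mem_univ i))

lemma aux_diam_ex (G : SimpleGraph V) [Nonempty V] : ∃ i j, G.dist i j = csrDiam G := by
  obtain ⟨i, _, hi⟩ := Finset.exists_mem_eq_sup (univ : Finset V) univ_nonempty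
    (fun i => Finset.sup Finset.univ fun j => G.dist i j)
  obtain ⟨j, _, hj⟩ := Finset.exists_mem_eq_sup (univ : Finset V) univ_nonempty
    (fun j => G.dist i j)
  exact ⟨i, j, by unfold csrDiam; rw [hi, hj]⟩

lemma aux_card (G : SimpleGraph V) [DecidableRel G.Adj] (i u : V) (B : Finset V) (T : Finset ℕ)
    (hN : insert i (G.neighborFinset i) ⊆ B)
    (hT : ∀ t ∈ T, ∃ w ∈ B, G.dist u w = t)
    (hd : ∀ w ∈ insert i (G.neighborFinset i), G.dist u w ∉ T) :
    G.degree i + 1 + T.card ≤ B.card := by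
  have h1 : (insert i (G.neighborFinset i)).card = G.degree i + 1 := by
    rw [card_insert_of_notMem (by simp), G.card_neighborFinset_eq_degree]
  have h2 : T ⊆ (B \ insert i (G.neighborFinset i)).image (fun w => G.dist u w) := by
    intro t ht
    obtain ⟨w, hw, rfl⟩ := hT t ht
    refine mem_image.2 ⟨w, mem_sdiff.2 ⟨hw, fun h => hd w h ht⟩, rfl⟩
  have h3 := (card_le_card h2).trans card_image_le
  have h4 := card_sdiff_add_card_eq_card hN
  omega

lemma aux_ball (G : SimpleGraph V) [DecidableRel G.Adj] (hconn : G.Connected) (i : V) (r : ℕ)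
    (hr : 1 ≤ r) (hrD : r < csrDiam G) : G.degree i + r ≤ (csrBall G i r).card := by
  have hadj : ∀ w ∈ insert i (G.neighborFinset i), G.dist i w ≤ 1 := by
    intro w hw
    rcases mem_insert.1 hw with rfl | hw
    · simp
    · rw [SimpleGraph.mem_neighborFinset] at hw
      exact (SimpleGraph.dist_eq_one_iff_adj.2 hw).le
  have hN : insert i (G.neighborFinset i) ⊆ csrBall G i r := by
    intro w hw
    simp only [csrBall, mem_filter, mem_univ, true_and]
    exact (hadj w hw).trans hr
  by_cases hv : ∃ v, r ≤ G.dist i v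
  · obtain ⟨v, hv⟩ := hv
    have := aux_card G i i (csrBall G i r) (Icc 2 r) hN (by
      intro t ht
      rw [mem_Icc] at ht
      obtain ⟨w, hw⟩ := aux_level G hconn i v t (by omega)
      exact ⟨w, by simp only [csrBall, mem_filter, mem_univ, true_and]; omega, hw⟩) (by
      intro w hw h
      have := hadj w hw
      rw [mem_Icc] at h
      omega)
    rw [Nat.card_Icc] at this
    omega
  · push Not at hv
    haveI : Nonempty V := ⟨i⟩
    obtain ⟨u, v, huv⟩ := aux_diam_ex G
    have := aux_card G i u (csrBall G i r)
      (range (csrDiam G + 1) \ Icc (G.dist u i - 1) (G.dist u i + 1)) hN (by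
      intro t ht
      rw [mem_sdiff, mem_range] at ht
      obtain ⟨w, hw⟩ := aux_level G hconn u v t (by omega)
      exact ⟨w, by simp only [csrBall, mem_filter, mem_univ, true_and]; exact (hv w).le, hw⟩) (by
      intro w hw h
      have h1 := hadj w hw
      have h2 := hconn.dist_triangle (u := u) (v := i) (w := w)
      have h3 := hconn.dist_triangle (u := u) (v := w) (w := i)
      rw [SimpleGraph.dist_comm (u := w) (v := i)] at h3
      rw [mem_sdiff, mem_Icc] at h
      apply h.2
      omega)
    have h4 := le_card_sdiff (Icc (G.dist u i - 1) (G.dist u i + 1)) (range (csrDiam G + 1))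
    rw [Nat.card_Icc, card_range] at h4
    omega

lemma aux_dist (G : SimpleGraph V) (P : V → O) (i : V) (o : O) :
    csrDist G P i o ≤ 2 + ∑ r ∈ Ico 1 (csrDiam G),
      if (∀ j ∈ csrBall G i r, P j ≠ o) then 1 else 0 := by
  have hle : csrDist G P i o ≤ csrDiam G + 1 := by
    unfold csrDist
    split_ifs with h
    · obtain ⟨j, hj⟩ := id h
      exact (Finset.inf'_le _ hj).trans ((aux_diam_le G i j).trans (Nat.le_succ _))
    · exact le_rfl
  have hlt : ∀ r, r < csrDist G P i o → ∀ j ∈ csrBall G i r, P j ≠ o := by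
    intro r hr j hj hPj
    simp only [csrBall, mem_filter, mem_univ, true_and] at hj
    have hm : j ∈ Finset.univ.filter fun j => P j = o := by simp [hPj]
    unfold csrDist at hr
    rw [dif_pos ⟨j, hm⟩] at hr
    have := Finset.inf'_le (fun j => G.dist i j) hm
    omega
  rw [← card_filter]
  have hs : Ico 1 (min (csrDist G P i o) (csrDiam G)) ⊆
      (Ico 1 (csrDiam G)).filter (fun r => ∀ j ∈ csrBall G i r, P j ≠ o) := by
    intro r hr
    rw [mem_Ico] at hr
    rw [mem_filter, mem_Ico]
    exact ⟨by omega, hlt r (by omega)⟩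
  have := card_le_card hs
  rw [Nat.card_Ico] at this
  omega

lemma aux_count (S : Finset V) (o : O) :
    (((univ : Finset (V → O)).filter (fun P => ∀ j ∈ S, P j ≠ o)).card : ℝ) =
      (Fintype.card O : ℝ) ^ (Fintype.card V) * (1 - 1 / (Fintype.card O : ℝ)) ^ S.card := by
  have h1 : (univ : Finset (V → O)).filter (fun P => ∀ j ∈ S, P j ≠ o) =
      Fintype.piFinset (fun j => if j ∈ S then univ.erase o else univ) := by
    ext P
    simp only [mem_filter, mem_univ, true_and, Fintype.mem_piFinset]
    refine forall_congr' fun j => ?_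
    split_ifs with h <;> simp [h]
  have hpos : 0 < Fintype.card O := Fintype.card_pos_iff.2 ⟨o⟩
  have hk : (Fintype.card O : ℝ) ≠ 0 := by positivity
  rw [h1, Fintype.card_piFinset, Nat.cast_prod]
  have h2 : ∀ j ∈ (univ : Finset V),
      (((if j ∈ S then univ.erase o else univ : Finset O).card : ℕ) : ℝ) =
      (Fintype.card O : ℝ) * (if j ∈ S then (1 - 1 / (Fintype.card O : ℝ)) else 1) := by
    intro j _
    split_ifs
    · rw [card_erase_of_mem (mem_univ _), card_univ, Nat.cast_sub hpos]
      field_simp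
      simp
    · simp
  rw [prod_congr rfl h2, prod_mul_distrib, prod_const, card_univ, prod_ite_mem, univ_inter,
    prod_const]

lemma aux_geom (q : ℝ) (h0 : 0 ≤ q) (h1 : q < 1) (d D : ℕ) :
    ∑ r ∈ Ico 1 D, q ^ (d + r) ≤ q ^ (d + 1) / (1 - q) := by
  have hm : ∀ m, ∑ r ∈ range m, q ^ r ≤ 1 / (1 - q) := by
    intro m
    have := geom_sum_mul_neg q m
    rw [le_div_iff₀ (by linarith), this]
    linarith [pow_nonneg h0 m]
  rw [sum_Ico_eq_sum_range]
  calc ∑ r ∈ range (D - 1), q ^ (d + (1 + r)) = q ^ (d + 1) * ∑ r ∈ range (D - 1), q ^ r := by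
        rw [mul_sum]
        refine sum_congr rfl fun r _ => ?_
        rw [← pow_add, add_assoc]
    _ ≤ q ^ (d + 1) * (1 / (1 - q)) := by gcongr; exact hm _
    _ = _ := by ring

lemma aux_single (G : SimpleGraph V) [DecidableRel G.Adj] (hconn : G.Connected)
    (hO2 : 2 ≤ Fintype.card O) (i : V) (o : O) :
    ∑ P : V → O, (if o ≠ P i then (csrDist G P i o : ℝ) else 0) ≤
      (Fintype.card O : ℝ) ^ (Fintype.card V) * (2 * (1 - 1 / (Fintype.card O : ℝ)) +
       ((Fintype.card O : ℝ) - 1) * (1 - 1 / (Fintype.card O : ℝ)) ^ (G.degree i)) := by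
  have hk : (2 : ℝ) ≤ Fintype.card O := by exact_mod_cast hO2
  set k : ℝ := (Fintype.card O : ℝ) with hkd
  have hq0 : 0 ≤ 1 - 1 / k := by
    rw [sub_nonneg, div_le_one (by linarith)]; linarith
  have hq1 : 1 - 1 / k < 1 := by
    have : 0 < 1 / k := by positivity
    linarith
  have hpt : ∀ P : V → O, (if o ≠ P i then (csrDist G P i o : ℝ) else 0) ≤
      2 * (if (∀ j ∈ ({i} : Finset V), P j ≠ o) then 1 else 0) +
      ∑ r ∈ Ico 1 (csrDiam G), if (∀ j ∈ csrBall G i r, P j ≠ o) then (1 : ℝ) else 0 := by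
    intro P
    by_cases h : P i = o
    · rw [if_neg (by simp [h])]
      have : 0 ≤ ∑ r ∈ Ico 1 (csrDiam G), if (∀ j ∈ csrBall G i r, P j ≠ o) then (1 : ℝ) else 0 :=
        sum_nonneg fun r _ => by split_ifs <;> norm_num
      split_ifs <;> linarith
    · rw [if_pos (Ne.symm h), if_pos (by simpa using h)]
      have := aux_dist G P i o
      have h2 : (csrDist G P i o : ℝ) ≤ ((2 + ∑ r ∈ Ico 1 (csrDiam G),
        if (∀ j ∈ csrBall G i r, P j ≠ o) then 1 else 0 : ℕ) : ℝ) := by exact_mod_cast this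
      push_cast at h2
      linarith
  refine (sum_le_sum fun P _ => hpt P).trans ?_
  rw [sum_add_distrib, ← mul_sum, sum_comm]
  simp_rw [sum_boole]
  simp_rw [aux_count]
  rw [card_singleton, pow_one, ← mul_sum, ← hkd]
  have h3 : ∑ r ∈ Ico 1 (csrDiam G), (1 - 1 / k) ^ (csrBall G i r).card ≤
      ∑ r ∈ Ico 1 (csrDiam G), (1 - 1 / k) ^ (G.degree i + r) := by
    refine sum_le_sum fun r hr => ?_
    rw [mem_Ico] at hr
    exact pow_le_pow_of_le_one hq0 hq1.le (aux_ball G hconn i r hr.1 hr.2)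
  have h4 := h3.trans (aux_geom _ hq0 hq1 (G.degree i) (csrDiam G))
  have h5 : (1 - 1 / k) ^ (G.degree i + 1) / (1 - (1 - 1 / k)) =
      (k - 1) * (1 - 1 / k) ^ (G.degree i) := by
    have : k ≠ 0 := by linarith
    rw [pow_succ, sub_sub_cancel]
    have h6 : (1 - 1 / k) = (k - 1) / k := by field_simp
    rw [mul_div_assoc, mul_comm]
    congr 1
    field_simp
  rw [h5] at h4
  have h7 := mul_le_mul_of_nonneg_left h4 (show 0 ≤ k ^ (Fintype.card V) by positivity)
  linarith

/-- Upper bound on the optimal allocation cost: there is an allocation `P`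
with `C(P) ≤ n(2|O| - 1) + |O|(|O| - 1) Σ_i (1 - 1/|O|)^{deg i}`. -/
theorem stmt7 (G : SimpleGraph V) [DecidableRel G.Adj] (hconn : G.Connected)
    (hO2 : 2 ≤ Fintype.card O) :
    ∃ P : V → O, (csrTotal G P : ℝ) ≤
      (Fintype.card V : ℝ) * (2 * (Fintype.card O : ℝ) - 1) +
        (Fintype.card O : ℝ) * ((Fintype.card O : ℝ) - 1) *
          ∑ i : V, (1 - 1 / (Fintype.card O : ℝ)) ^ (G.degree i) := by
  have hk : (2 : ℝ) ≤ Fintype.card O := by exact_mod_cast hO2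
  haveI : Nonempty O := Fintype.card_pos_iff.1 (by omega)
  suffices h : ∃ P ∈ (univ : Finset (V → O)), (csrTotal G P : ℝ) ≤
      (Fintype.card V : ℝ) * (2 * (Fintype.card O : ℝ) - 1) +
        (Fintype.card O : ℝ) * ((Fintype.card O : ℝ) - 1) *
          ∑ i : V, (1 - 1 / (Fintype.card O : ℝ)) ^ (G.degree i) by
    obtain ⟨P, _, hP⟩ := h
    exact ⟨P, hP⟩
  apply exists_le_of_sum_le univ_nonempty
  have h1 : ∑ P : V → O, (csrTotal G P : ℝ) =
      ∑ i : V, ∑ o : O, ∑ P : V → O, (if o ≠ P i then (csrDist G P i o : ℝ) else 0) := by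
    have : ∀ P : V → O, (csrTotal G P : ℝ) =
        ∑ i : V, ∑ o : O, (if o ≠ P i then (csrDist G P i o : ℝ) else 0) := by
      intro P
      unfold csrTotal csrCost
      push_cast
      simp_rw [sum_filter]
    simp_rw [this]
    rw [sum_comm]
    exact sum_congr rfl fun i _ => sum_comm
  rw [h1]
  refine (sum_le_sum fun i _ => sum_le_sum fun o _ => aux_single G hconn hO2 i o).trans ?_
  simp only [sum_const, card_univ, nsmul_eq_mul, Fintype.card_fun, Nat.cast_pow]
  rw [← mul_sum, ← mul_sum, sum_add_distrib, sum_const, card_univ, nsmul_eq_mul, ← mul_sum]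
  set k : ℝ := (Fintype.card O : ℝ) with hkd
  have hn : (0 : ℝ) ≤ Fintype.card V := by positivity
  have hk2 : k * (1 - 1 / k) = k - 1 := by
    have : k ≠ 0 := by linarith
    field_simp
  rw [mul_left_comm]
  refine mul_le_mul_of_nonneg_left ?_ (by positivity)
  rw [mul_add, ← mul_assoc k (k - 1)]
  refine add_le_add ?_ le_rfl
  calc k * ((Fintype.card V : ℝ) * (2 * (1 - 1 / k))) =
      (Fintype.card V : ℝ) * (2 * (k * (1 - 1 / k))) := by ring
    _ ≤ _ := by
      rw [hk2]
      exact mul_le_mul_of_nonneg_left (by linarith) hn
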